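/- Let k ≥ 2 and T'_k = (σ₁σ₃)^{2k−2}(σ₃σ₄Δ₃)(Δ₃σ₄)[(δ₃σ₄)(δ̃₃σ₄)]^{k−1}(δ₃σ₄σ₃σ₄) ∈ B₅. Then each of the two conjugates σ₃⁻¹ T'_k σ₃ and (σ₂σ₁σ₃σ₂)⁻¹ T'_k (σ₂σ₁σ₃σ₂) is a positive braid which is a prefix of Δ^{4k−1}; in particular each has canonical length 4k−1 and belongs to the super summit set of T'_k. Explicitly, σ₃⁻¹T'_kσ₃ = (σ₁σ₃)^{2k−3}(σ₃σ₄Δ₃)(Δ₃σ₄)²(δ̃₃σ₄)[(δ₃σ₄)(δ̃₃σ₄)]^{k−2}(δ₃σ₄σ₃σ₄)σ₃ and (σ₂σ₁σ₃σ₂)⁻¹T'_k(σ₂σ₁σ₃σ₂) = (σ₃σ₄σ₃Δ₃)(σ₂σ₄)^{2k−2}(δ₃σ₃σ₄σ₃)(σ₁σ₄σ₃)[(σ₁σ₃σ₄)(σ₁σ₄σ₃)]^{k−1}. -/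

import Mathlib

/-- Defining relations of the braid group on 5 strands, as elements of the
free group on four generators (generator `i` corresponds to `σ_{i+1}`). -/
def braidRels : Set (FreeGroup (Fin 4)) :=
  { r | (∃ i : Fin 3, r = FreeGroup.of i.castSucc * FreeGroup.of i.succ * FreeGroup.of i.castSucc *
          (FreeGroup.of i.succ * FreeGroup.of i.castSucc * FreeGroup.of i.succ)⁻¹) ∨
        (∃ i j : Fin 4, 2 ≤ |(i : ℤ) - (j : ℤ)| ∧
          r = FreeGroup.of i * FreeGroup.of j * (FreeGroup.of j * FreeGroup.of i)⁻¹) }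

/-- The Artin braid group on 5 strands. -/
abbrev B5 : Type := PresentedGroup braidRels

/-- The Artin generators (index `i` corresponds to `σ_{i+1}`). -/
def gen (i : Fin 4) : B5 := PresentedGroup.of i

def s1 : B5 := gen 0
def s2 : B5 := gen 1
def s3 : B5 := gen 2
def s4 : B5 := gen 3

/-- A braid is positive if it lies in the submonoid generated by `σ₁,…,σ₄`. -/
def IsPos (x : B5) : Prop := x ∈ Submonoid.closure (Set.range gen)

/-- Prefix order: `Pre x y` means `x ≼ y`, i.e. `x⁻¹ y` is positive. -/
def Pre (x y : B5) : Prop := IsPos (x⁻¹ * y)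

/-- The half twist `Δ = σ₁σ₂σ₃σ₄σ₁σ₂σ₃σ₁σ₂σ₁`. -/
def Δ : B5 := s1*s2*s3*s4*s1*s2*s3*s1*s2*s1

def δ3 : B5 := s2*s1
def Δ3 : B5 := s2*s1*s2
def δt3 : B5 := s1*s2

/-- A braid `s` is simple if `1 ≼ s ≼ Δ`. -/
def IsSimple (s : B5) : Prop := IsPos s ∧ Pre s Δ

/-- Two simple braids `s, t` are left-weighted if no generator `σᵢ` is such that
`s σᵢ` and `σᵢ⁻¹ t` are both simple. -/
def LeftWeighted (s t : B5) : Prop :=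
  ¬ ∃ i : Fin 4, IsSimple (s * gen i) ∧ IsSimple ((gen i)⁻¹ * t)

/-- The canonical length of `z`: the minimum of `q - p` over `p ≤ q` with
`Δ^p ≼ z` and `z ≼ Δ^q`. -/
noncomputable def canLen (z : B5) : ℕ :=
  sInf { n : ℕ | ∃ p q : ℤ, p ≤ q ∧ q - p = (n : ℤ) ∧ Pre (Δ ^ p) z ∧ Pre z (Δ ^ q) }

/-- `y` belongs to the super summit set of `x`:
`y` is conjugate to `x` and has minimal canonical length among conjugates of `x`. -/
def InSSS (x y : B5) : Prop :=
  IsConj x y ∧ ∀ z : B5, IsConj x z → canLen y ≤ canLen z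

/-- The braid `T_k = δ₃^{3k+1} σ₄^{2k+2} σ₃ σ₄^{2k-1}`. -/
def T (k : ℕ) : B5 := δ3 ^ (3*k+1) * s4 ^ (2*k+2) * s3 * s4 ^ (2*k-1)

/-- The braid `T'_k`, a rigid conjugate of `T_k`. -/
def T' (k : ℕ) : B5 :=
  (s1*s3)^(2*k-2) * (s3*s4*Δ3) * (Δ3*s4) * ((δ3*s4)*(δt3*s4))^(k-1) * (δ3*s4*s3*s4)

/-! ### Words in the generators -/

/-- The braid represented by a word. -/
def braid : FreeMonoid (Fin 4) →* B5 := FreeMonoid.lift gen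

/-- The word with the given list of letters. -/
abbrev word (l : List (Fin 4)) : FreeMonoid (Fin 4) := FreeMonoid.ofList l

theorem braid_word_nil : braid (word []) = 1 := rfl

theorem braid_word_cons (a : Fin 4) (l : List (Fin 4)) :
    braid (word (a :: l)) = gen a * braid (word l) := by
  simp [braid, word, FreeMonoid.ofList_cons]

theorem isPos_iff {x : B5} : IsPos x ↔ ∃ w, braid w = x := by
  rw [IsPos, ← FreeMonoid.mrange_lift, MonoidHom.mem_mrange]
  rfl

theorem isPos_braid (w : FreeMonoid (Fin 4)) : IsPos (braid w) := isPos_iff.2 ⟨w, rfl⟩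

theorem IsPos.mul {x y : B5} (hx : IsPos x) (hy : IsPos y) : IsPos (x * y) := mul_mem hx hy

theorem IsPos.pow {x : B5} (hx : IsPos x) (n : ℕ) : IsPos (x ^ n) := pow_mem hx n

theorem gen_comm {i j : Fin 4} (h : 2 ≤ |(i : ℤ) - (j : ℤ)|) : gen i * gen j = gen j * gen i := by
  have := PresentedGroup.one_of_mem (rels := braidRels) (Or.inr ⟨i, j, h, rfl⟩)
  rw [map_mul, map_inv, mul_inv_eq_one] at this
  simpa [gen, PresentedGroup.of] using this

theorem gen_braid_succ (i : Fin 3) :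
    gen i.castSucc * gen i.succ * gen i.castSucc = gen i.succ * gen i.castSucc * gen i.succ := by
  have := PresentedGroup.one_of_mem (rels := braidRels) (Or.inl ⟨i, rfl⟩)
  rw [map_mul, map_inv, mul_inv_eq_one] at this
  simpa [gen, PresentedGroup.of] using this

theorem gen_braid {i j : Fin 4} (h : ¬2 ≤ |(i : ℤ) - (j : ℤ)|) :
    gen i * gen j * gen i = gen j * gen i * gen j := by
  have h0 := gen_braid_succ 0
  have h1 := gen_braid_succ 1
  have h2 := gen_braid_succ 2
  fin_cases i <;> fin_cases j <;>
    first
    | rfl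
    | exact h0
    | exact h0.symm
    | exact h1
    | exact h1.symm
    | exact h2
    | exact h2.symm
    | (exfalso; revert h; decide)

/-- Left division of a positive word by a generator; the first argument bounds the
recursion depth. -/
def divGen : ℕ → Fin 4 → List (Fin 4) → Option (List (Fin 4))
  | 0, _, _ => none
  | _ + 1, _, [] => none
  | n + 1, a, b :: l =>
    if a = b then some l
    else (divGen n a l).bind fun l' =>
      if 2 ≤ |(a : ℤ) - (b : ℤ)| then some (b :: l')
      else (divGen n b l').map fun l'' => b :: a :: l''

theorem braid_of_divGen {n : ℕ} {a : Fin 4} {l r : List (Fin 4)} (h : divGen n a l = some r) :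
    braid (word l) = gen a * braid (word r) := by
  induction n generalizing a l r with
  | zero => simp [divGen] at h
  | succ n ih =>
    cases l with
    | nil => simp [divGen] at h
    | cons b l =>
      rw [divGen] at h
      by_cases hab : a = b
      · rw [if_pos hab] at h
        rw [hab, braid_word_cons, Option.some.inj h]
      · rw [if_neg hab] at h
        obtain ⟨l', h1, h⟩ := Option.bind_eq_some_iff.1 h
        by_cases h2 : 2 ≤ |(a : ℤ) - (b : ℤ)|
        · rw [if_pos h2] at h
          rw [← Option.some.inj h, braid_word_cons, braid_word_cons, ih h1, ← mul_assoc,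
            ← mul_assoc, gen_comm h2]
        · rw [if_neg h2] at h
          obtain ⟨l'', h3, rfl⟩ := Option.map_eq_some_iff.1 h
          rw [braid_word_cons, braid_word_cons, braid_word_cons, ih h1, ih h3]
          simp only [← mul_assoc, gen_braid h2]

/-- Left division of a positive word by another one. -/
def divWord : List (Fin 4) → List (Fin 4) → Option (List (Fin 4))
  | [], l => some l
  | a :: u, l => (divGen l.length a l).bind (divWord u)

theorem braid_of_divWord {u l r : List (Fin 4)} (h : divWord u l = some r) :
    braid (word u) * braid (word r) = braid (word l) := by
  induction u generalizing l with
  | nil => rw [Option.some.inj h, braid_word_nil, one_mul]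
  | cons a u ih =>
    obtain ⟨l', h1, h⟩ := Option.bind_eq_some_iff.1 h
    rw [braid_of_divGen h1, ← ih h, braid_word_cons, mul_assoc]

theorem braid_eq_of_divWord {u l : List (Fin 4)} (h : divWord u l = some []) :
    braid (word u) = braid (word l) := by
  rw [← braid_of_divWord h, braid_word_nil, mul_one]

/-! ### The half twist -/

/-- A word for the half twist. -/
abbrev halfTwist : List (Fin 4) := [0, 1, 2, 3, 0, 1, 2, 0, 1, 0]

theorem braid_halfTwist : braid (word halfTwist) = Δ := by
  simp only [braid_word_cons, braid_word_nil, Δ, s1, s2, s3, s4, mul_assoc, mul_one]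

theorem isPos_Δ : IsPos Δ := braid_halfTwist ▸ isPos_braid _

theorem gen_mul_Δ (i : Fin 4) : gen i * Δ = Δ * gen i.rev := by
  have h : braid (word (i :: halfTwist)) = braid (word (halfTwist ++ [i.rev])) := by
    apply braid_eq_of_divWord
    revert i
    decide +kernel
  have h' : braid (word (halfTwist ++ [i.rev])) = Δ * gen i.rev := by
    rw [word, FreeMonoid.ofList_append, map_mul]
    change braid (word halfTwist) * braid (word [i.rev]) = _
    rw [braid_halfTwist, braid_word_cons, braid_word_nil, mul_one]
  rw [← h', ← h, braid_word_cons, braid_halfTwist]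

/-- The word automorphism induced by conjugation by the half twist. -/
def flipWord : FreeMonoid (Fin 4) →* FreeMonoid (Fin 4) := FreeMonoid.map Fin.rev

theorem braid_mul_Δ (w : FreeMonoid (Fin 4)) : braid w * Δ = Δ * braid (flipWord w) := by
  induction w using FreeMonoid.inductionOn' with
  | one => simp
  | of_mul i w ih =>
    have : braid (.of i) = gen i := by simp [braid]
    have h' : braid (flipWord (.of i)) = gen i.rev := by simp [braid, flipWord]
    rw [map_mul, mul_assoc, ih, ← mul_assoc, this, gen_mul_Δ, map_mul, map_mul, h', mul_assoc]

theorem flipWord_flipWord (w : FreeMonoid (Fin 4)) : flipWord (flipWord w) = w := by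
  rw [flipWord, FreeMonoid.map_map, Fin.rev_involutive.comp_self, FreeMonoid.map_id,
    MonoidHom.id_apply]

theorem braid_flipWord_mul_Δ (w : FreeMonoid (Fin 4)) : braid (flipWord w) * Δ = Δ * braid w := by
  rw [braid_mul_Δ, flipWord_flipWord]

theorem closure_range_gen : Subgroup.closure (Set.range gen) = ⊤ :=
  PresentedGroup.closure_range_of braidRels

theorem commute_Δ_sq (x : B5) : Commute x (Δ ^ 2) := by
  have hx : x ∈ Subgroup.closure (Set.range gen) := closure_range_gen ▸ Subgroup.mem_top x
  induction hx using Subgroup.closure_induction with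
  | mem y hy =>
    obtain ⟨i, rfl⟩ := hy
    rw [commute_iff_eq, pow_two, ← mul_assoc, gen_mul_Δ, mul_assoc, gen_mul_Δ, Fin.rev_rev,
      mul_assoc]
  | one => exact Commute.one_left _
  | mul y z _ _ hy hz => exact hy.mul_left hz
  | inv y _ hy => exact hy.inv_left

theorem exists_isPos_mul (x : B5) : ∃ n : ℕ, IsPos (x * (Δ ^ 2) ^ n) := by
  have hx : x ∈ Subgroup.closure (Set.range gen) := closure_range_gen ▸ Subgroup.mem_top x
  induction hx using Subgroup.closure_induction'' with
  | one => exact ⟨0, by simpa using isPos_braid 1⟩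
  | mem y hy => exact ⟨0, by rw [pow_zero, mul_one]; exact Submonoid.subset_closure hy⟩
  | inv_mem y hy =>
    obtain ⟨i, rfl⟩ := hy
    have h : ∀ i, (divWord [i] halfTwist).isSome := by decide +kernel
    obtain ⟨r, hr⟩ := Option.isSome_iff_exists.1 (h i)
    have h' := braid_of_divWord hr
    rw [braid_word_cons, braid_word_nil, mul_one, braid_halfTwist] at h'
    refine ⟨1, ?_⟩
    have : (gen i)⁻¹ * Δ = braid (word r) := by rw [← h', inv_mul_cancel_left]
    rw [pow_one, pow_two, ← mul_assoc, this]
    exact (isPos_braid _).mul isPos_Δ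
  | mul y z _ _ hy hz =>
    obtain ⟨a, ha⟩ := hy
    obtain ⟨b, hb⟩ := hz
    refine ⟨a + b, ?_⟩
    have : y * z * (Δ ^ 2) ^ (a + b) = y * (Δ ^ 2) ^ a * (z * (Δ ^ 2) ^ b) := by
      rw [pow_add, mul_assoc, ← mul_assoc z, ((commute_Δ_sq z).pow_right a).eq]
      simp only [mul_assoc]
    rw [this]
    exact ha.mul hb

theorem IsPos.conj_Δ {x : B5} (hx : IsPos x) : IsPos (Δ⁻¹ * x * Δ) := by
  obtain ⟨w, rfl⟩ := isPos_iff.1 hx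
  rw [mul_assoc, braid_mul_Δ, inv_mul_cancel_left]
  exact isPos_braid _

theorem IsPos.conj_Δ_inv {x : B5} (hx : IsPos x) : IsPos (Δ * x * Δ⁻¹) := by
  obtain ⟨w, rfl⟩ := isPos_iff.1 hx
  rw [← braid_flipWord_mul_Δ, mul_inv_cancel_right]
  exact isPos_braid _

theorem IsPos.conj_Δ_zpow {x : B5} (hx : IsPos x) (n : ℤ) :
    IsPos ((Δ ^ n)⁻¹ * x * Δ ^ n) := by
  induction n using Int.induction_on with
  | zero => simpa using hx
  | succ i ih =>
    have := ih.conj_Δ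
    rw [zpow_add_one, mul_inv_rev]
    simpa only [mul_assoc] using this
  | pred i ih =>
    have := ih.conj_Δ_inv
    rw [zpow_sub_one, mul_inv_rev, inv_inv]
    simpa only [mul_assoc] using this

theorem Pre.mul_Δ_zpow {x y : B5} {a b : ℤ} (hx : Pre x (Δ ^ a)) (hy : Pre y (Δ ^ b)) :
    Pre (x * y) (Δ ^ (a + b)) := by
  have : (x * y)⁻¹ * Δ ^ (a + b) =
      y⁻¹ * Δ ^ b * ((Δ ^ b)⁻¹ * (x⁻¹ * Δ ^ a) * Δ ^ b) := by
    rw [zpow_add]; group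
  rw [Pre, this]
  exact IsPos.mul hy (IsPos.conj_Δ_zpow hx b)

theorem Pre.pow_Δ_zpow {x : B5} {a : ℤ} (hx : Pre x (Δ ^ a)) (n : ℕ) :
    Pre (x ^ n) (Δ ^ (n * a)) := by
  induction n with
  | zero => simpa [Pre] using isPos_braid 1
  | succ n ih =>
    rw [pow_succ, Nat.cast_succ, add_one_mul]
    exact ih.mul_Δ_zpow hx

theorem Pre.Δ_zpow_mul {x y : B5} {a b : ℤ} (hx : Pre (Δ ^ a) x) (hy : Pre (Δ ^ b) y) :
    Pre (Δ ^ (a + b)) (x * y) := by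
  have : (Δ ^ (a + b))⁻¹ * (x * y) =
      (Δ ^ b)⁻¹ * ((Δ ^ a)⁻¹ * x) * Δ ^ b * ((Δ ^ b)⁻¹ * y) := by
    rw [zpow_add]; group
  rw [Pre, this]
  exact (IsPos.conj_Δ_zpow hx b).mul hy

theorem Pre.Δ_zpow_pow {x : B5} {a : ℤ} (hx : Pre (Δ ^ a) x) (n : ℕ) :
    Pre (Δ ^ (n * a)) (x ^ n) := by
  induction n with
  | zero => simpa [Pre] using isPos_braid 1
  | succ n ih =>
    rw [pow_succ, Nat.cast_succ, add_one_mul]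
    exact ih.Δ_zpow_mul hx

theorem pre_Δ_of_divWord {l : List (Fin 4)} (h : (divWord l halfTwist).isSome) :
    Pre (braid (word l)) (Δ ^ (1 : ℤ)) := by
  obtain ⟨r, hr⟩ := Option.isSome_iff_exists.1 h
  rw [zpow_one, Pre, ← braid_halfTwist, ← braid_of_divWord hr, inv_mul_cancel_left]
  exact isPos_braid _

/-! ### The Lawrence–Krammer action at `q = 1/2` -/

/-- The generators in the Lawrence–Krammer representation of `B5` at `q = 1/2`. -/
noncomputable def lkGen (t : ℝ) : Fin 4 → (Fin 10 → ℝ) → Fin 10 → ℝ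
  | 0, v =>
    ![1/4 * t * v 0 - 1/4 * t * v 1 - 1/4 * t * v 2 - 1/4 * t * v 3, v 4, v 5, v 6,
      1/2 * v 1 + 1/2 * v 4, 1/2 * v 2 + 1/2 * v 5, 1/2 * v 3 + 1/2 * v 6, v 7, v 8, v 9]
  | 1, v =>
    ![1/2 * v 0 + v 1, 1/2 * v 0, v 2, v 3,
      (-1/8) * t * v 1 + 1/8 * t * v 2 + 1/8 * t * v 3 + 1/4 * t * v 4 - 1/4 * t * v 5 +
        (-1/4) * t * v 6, v 7, v 8, 1/2 * v 5 + 1/2 * v 7, 1/2 * v 6 + 1/2 * v 8, v 9]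
  | 2, v =>
    ![v 0, 1/2 * v 1 + v 2, 1/2 * v 1, v 3, 1/2 * v 4 + v 5, 1/2 * v 4, v 6,
      (-1/16) * t * v 2 + 1/16 * t * v 3 - 1/8 * t * v 5 + 1/8 * t * v 6 + 1/4 * t * v 7 +
        (-1/4) * t * v 8, v 9, 1/2 * v 8 + 1/2 * v 9]
  | 3, v =>
    ![v 0, v 1, 1/2 * v 2 + v 3, 1/2 * v 2, v 4, 1/2 * v 5 + v 6, 1/2 * v 5, 1/2 * v 7 + v 8,
      1/2 * v 7, (-1/32) * t * v 3 - 1/16 * t * v 6 - 1/8 * t * v 8 + 1/4 * t * v 9]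

/-- The inverses of the generators in the Lawrence–Krammer representation at `q = 1/2`. -/
noncomputable def lkGenInv (t : ℝ) : Fin 4 → (Fin 10 → ℝ) → Fin 10 → ℝ
  | 0, v =>
    ![4 * t⁻¹ * v 0 - v 1 - v 2 - v 3 + 2 * v 4 + 2 * v 5 + 2 * v 6,
      -1 * v 1 + 2 * v 4, -1 * v 2 + 2 * v 5, -1 * v 3 + 2 * v 6, v 1, v 2, v 3, v 7, v 8,
      v 9]
  | 1, v =>
    ![2 * v 1, v 0 - v 1, v 2, v 3,
      1/2 * v 0 - 1/2 * v 1 - 1/2 * v 2 - 1/2 * v 3 + 4 * t⁻¹ * v 4 - v 5 +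
        -1 * v 6 + 2 * v 7 + 2 * v 8, -1 * v 5 + 2 * v 7, -1 * v 6 + 2 * v 8, v 5, v 6, v 9]
  | 2, v =>
    ![v 0, 2 * v 2, v 1 - v 2, v 3, 2 * v 5, v 4 - v 5, v 6,
      1/4 * v 1 - 1/4 * v 2 - 1/4 * v 3 + 1/2 * v 4 - 1/2 * v 5 - 1/2 * v 6 +
        4 * t⁻¹ * v 7 - v 8 + 2 * v 9, -1 * v 8 + 2 * v 9, v 8]
  | 3, v =>
    ![v 0, v 1, 2 * v 3, v 2 - v 3, v 4, 2 * v 6, v 5 - v 6, 2 * v 8,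
      v 7 - v 8,
      1/8 * v 2 - 1/8 * v 3 + 1/4 * v 5 - 1/4 * v 6 + 1/2 * v 7 - 1/2 * v 8 +
        4 * t⁻¹ * v 9]

theorem lkGenInv_lkGen {t : ℝ} (ht : t ≠ 0) (i : Fin 4) (v : Fin 10 → ℝ) :
    lkGenInv t i (lkGen t i v) = v := by
  ext j
  fin_cases i <;> fin_cases j <;> simp [lkGen, lkGenInv] <;> field_simp <;> ring

theorem lkGen_lkGenInv {t : ℝ} (ht : t ≠ 0) (i : Fin 4) (v : Fin 10 → ℝ) :
    lkGen t i (lkGenInv t i v) = v := by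
  ext j
  fin_cases i <;> fin_cases j <;> simp [lkGen, lkGenInv] <;> field_simp <;> ring

/-- The Lawrence–Krammer generators as permutations, for invertible `t`. -/
noncomputable def lkPerm (t : ℝ) (ht : t ≠ 0) (i : Fin 4) : Equiv.Perm (Fin 10 → ℝ) where
  toFun := lkGen t i
  invFun := lkGenInv t i
  left_inv := lkGenInv_lkGen ht i
  right_inv := lkGen_lkGenInv ht i

theorem lkGen_braid (t : ℝ) (i : Fin 3) (v : Fin 10 → ℝ) :
    lkGen t i.castSucc (lkGen t i.succ (lkGen t i.castSucc v)) =
      lkGen t i.succ (lkGen t i.castSucc (lkGen t i.succ v)) := by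
  ext j
  fin_cases i <;> fin_cases j <;> simp [lkGen] <;> ring

theorem lkGen_comm_zero_two (t : ℝ) (v : Fin 10 → ℝ) :
    lkGen t 0 (lkGen t 2 v) = lkGen t 2 (lkGen t 0 v) := by
  ext j
  fin_cases j <;> simp [lkGen] <;> ring

theorem lkGen_comm_zero_three (t : ℝ) (v : Fin 10 → ℝ) :
    lkGen t 0 (lkGen t 3 v) = lkGen t 3 (lkGen t 0 v) := by
  ext j
  fin_cases j <;> simp [lkGen] <;> ring

theorem lkGen_comm_one_three (t : ℝ) (v : Fin 10 → ℝ) :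
    lkGen t 1 (lkGen t 3 v) = lkGen t 3 (lkGen t 1 v) := by
  ext j
  fin_cases j <;> simp [lkGen] <;> ring

theorem lkGen_comm (t : ℝ) (i j : Fin 4) (h : 2 ≤ |(i : ℤ) - (j : ℤ)|) (v : Fin 10 → ℝ) :
    lkGen t i (lkGen t j v) = lkGen t j (lkGen t i v) := by
  have hij : i = 0 ∧ j = 2 ∨ i = 2 ∧ j = 0 ∨ i = 0 ∧ j = 3 ∨ i = 3 ∧ j = 0 ∨
      i = 1 ∧ j = 3 ∨ i = 3 ∧ j = 1 := by
    revert i j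
    decide
  rcases hij with ⟨rfl, rfl⟩ | ⟨rfl, rfl⟩ | ⟨rfl, rfl⟩ | ⟨rfl, rfl⟩ | ⟨rfl, rfl⟩ | ⟨rfl, rfl⟩
  · exact lkGen_comm_zero_two t v
  · exact (lkGen_comm_zero_two t v).symm
  · exact lkGen_comm_zero_three t v
  · exact (lkGen_comm_zero_three t v).symm
  · exact lkGen_comm_one_three t v
  · exact (lkGen_comm_one_three t v).symm

/-- The Lawrence–Krammer action of `B5` at `q = 1/2` and invertible `t`. -/
noncomputable def lkHom (t : ℝ) (ht : t ≠ 0) : B5 →* Equiv.Perm (Fin 10 → ℝ) :=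
  PresentedGroup.toGroup (f := lkPerm t ht) (by
    rintro r (⟨i, rfl⟩ | ⟨i, j, h, rfl⟩)
    · rw [map_mul, map_inv, mul_inv_eq_one]
      ext1 v
      simpa [lkPerm] using lkGen_braid t i v
    · rw [map_mul, map_inv, mul_inv_eq_one]
      ext1 v
      simpa [lkPerm] using lkGen_comm t i j h v)

/-- The Lawrence–Krammer action of positive words at `q = 1/2`, also for `t = 0`. -/
noncomputable def lkAct (t : ℝ) : FreeMonoid (Fin 4) →* Function.End (Fin 10 → ℝ) :=
  FreeMonoid.lift (M := Function.End (Fin 10 → ℝ)) (lkGen t)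

theorem lkAct_one (t : ℝ) (v : Fin 10 → ℝ) : lkAct t 1 v = v := by
  rw [map_one]; rfl

theorem lkAct_mul (t : ℝ) (w w' : FreeMonoid (Fin 4)) (v : Fin 10 → ℝ) :
    lkAct t (w * w') v = lkAct t w (lkAct t w' v) := by
  rw [map_mul]; rfl

theorem lkAct_of (t : ℝ) (i : Fin 4) (v : Fin 10 → ℝ) : lkAct t (.of i) v = lkGen t i v := by
  exact congrFun (FreeMonoid.lift_eval_of (M := Function.End (Fin 10 → ℝ)) (lkGen t) i) v

theorem lkHom_braid (t : ℝ) (ht : t ≠ 0) (w : FreeMonoid (Fin 4)) (v : Fin 10 → ℝ) :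
    lkHom t ht (braid w) v = lkAct t w v := by
  induction w using FreeMonoid.inductionOn' with
  | one => rw [map_one, map_one, lkAct_one]; rfl
  | of_mul i w ih =>
    rw [map_mul, map_mul, Equiv.Perm.mul_apply, ih, lkAct_mul, lkAct_of]
    simp [braid, gen, lkHom, lkPerm]

theorem continuous_lkGen (i : Fin 4) :
    Continuous fun p : ℝ × (Fin 10 → ℝ) => lkGen p.1 i p.2 := by
  refine continuous_pi fun j => ?_
  fin_cases i <;> fin_cases j <;> simp [lkGen] <;> fun_prop

theorem continuous_lkAct (w : FreeMonoid (Fin 4)) (v : Fin 10 → ℝ) :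
    Continuous fun t => lkAct t w v := by
  induction w using FreeMonoid.inductionOn' with
  | one => simpa only [lkAct_one] using continuous_const
  | of_mul i w ih =>
    simp only [lkAct_mul, lkAct_of]
    exact (continuous_lkGen i).comp (continuous_id.prodMk ih)

theorem lkAct_eq_of_braid_eq {w w' : FreeMonoid (Fin 4)} (h : braid w = braid w') (t : ℝ)
    (v : Fin 10 → ℝ) : lkAct t w v = lkAct t w' v := by
  refine congrFun (Continuous.ext_on (dense_compl_singleton (0 : ℝ)) (continuous_lkAct w v)
    (continuous_lkAct w' v) fun s hs => ?_) t
  simp only [← lkHom_braid s hs, h]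

theorem lkAct_apply_zero (t : ℝ) (w : FreeMonoid (Fin 4)) : lkAct t w 0 = 0 := by
  induction w using FreeMonoid.inductionOn' with
  | one => exact lkAct_one t 0
  | of_mul i w ih =>
    rw [lkAct_mul, ih, lkAct_of]
    ext j
    fin_cases i <;> fin_cases j <;> simp [lkGen]

theorem lkAct_zero_halfTwist (v : Fin 10 → ℝ) : lkAct 0 (word halfTwist) v = 0 := by
  ext j
  simp only [halfTwist, word, FreeMonoid.ofList_cons, FreeMonoid.ofList_nil, lkAct_mul, lkAct_of,
    lkAct_one]
  fin_cases j <;> simp [lkGen]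

theorem lkAct_zero_eq_zero {w : FreeMonoid (Fin 4)} {x : B5} (hx : IsPos x) {n : ℕ}
    (h : braid w = x * Δ ^ (n + 1)) (v : Fin 10 → ℝ) : lkAct 0 w v = 0 := by
  obtain ⟨u, hu⟩ := isPos_iff.1 (hx.mul (isPos_Δ.pow n))
  have : braid w = braid (u * word halfTwist) := by
    rw [h, map_mul, hu, braid_halfTwist, pow_succ, mul_assoc]
  rw [lkAct_eq_of_braid_eq this, lkAct_mul, lkAct_zero_halfTwist, lkAct_apply_zero]

/-! ### Nonvanishing of the action at `t = 0` -/

/-- `Transition w e f`: at `t = 0` the word `w` preserves nonnegative vectors, and maps those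
with positive `e`-th coordinate to vectors with positive `f`-th coordinate. -/
def Transition (w : FreeMonoid (Fin 4)) (e f : Fin 10) : Prop :=
  ∀ v : Fin 10 → ℝ, 0 ≤ v → 0 < v e → 0 ≤ lkAct 0 w v ∧ 0 < lkAct 0 w v f

theorem Transition.mul {w w' : FreeMonoid (Fin 4)} {e f g : Fin 10} (h : Transition w f g)
    (h' : Transition w' e f) : Transition (w * w') e g := by
  intro v hv he
  rw [lkAct_mul]
  exact h _ (h' v hv he).1 (h' v hv he).2

theorem Transition.one (e : Fin 10) : Transition 1 e e := fun v hv he => by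
  rw [lkAct_one]; exact ⟨hv, he⟩

theorem Transition.pow {w : FreeMonoid (Fin 4)} {e : Fin 10} (h : Transition w e e) (n : ℕ) :
    Transition (w ^ n) e e := by
  induction n with
  | zero => exact .one e
  | succ n ih => rw [pow_succ]; exact ih.mul h

theorem Transition.ne_zero {w : FreeMonoid (Fin 4)} {e f : Fin 10} (h : Transition w e f) :
    ∃ v, lkAct 0 w v ≠ 0 := by
  refine ⟨1, fun h0 => ?_⟩
  have := (h 1 zero_le_one one_pos).2
  simp [h0] at this

/-- The positions of the nonzero entries in the `f`-th row of the matrix of the `i`-th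
generator at `t = 0`. -/
def support (i : Fin 4) (f : Fin 10) : List (Fin 10) :=
  match i with
  | 0 => [[], [4], [5], [6], [1, 4], [2, 5], [3, 6], [7], [8], [9]][f]
  | 1 => [[0, 1], [0], [2], [3], [], [7], [8], [5, 7], [6, 8], [9]][f]
  | 2 => [[0], [1, 2], [1], [3], [4, 5], [4], [6], [], [9], [8, 9]][f]
  | 3 => [[0], [1], [2, 3], [2], [4], [5, 6], [5], [7, 8], [7], []][f]

theorem transition_of {i : Fin 4} {e f : Fin 10} (h : e ∈ support i f) :
    Transition (.of i) e f := by
  intro v hv he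
  rw [lkAct_of]
  have h0 : 0 ≤ v 0 := hv 0
  have h1 : 0 ≤ v 1 := hv 1
  have h2 : 0 ≤ v 2 := hv 2
  have h3 : 0 ≤ v 3 := hv 3
  have h4 : 0 ≤ v 4 := hv 4
  have h5 : 0 ≤ v 5 := hv 5
  have h6 : 0 ≤ v 6 := hv 6
  have h7 : 0 ≤ v 7 := hv 7
  have h8 : 0 ≤ v 8 := hv 8
  have h9 : 0 ≤ v 9 := hv 9
  constructor
  · intro j
    fin_cases i <;> fin_cases j <;> simp [lkGen] <;> linarith
  · fin_cases i <;> fin_cases f <;> simp [support] at h <;>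
      first
      | (subst h; simpa [lkGen] using he)
      | (obtain rfl | rfl := h <;> simp [lkGen] <;> linarith)

/-- Whether a path from `e` to `f` of nonzero entries exists along a word. -/
def path : List (Fin 4) → Fin 10 → Fin 10 → Bool
  | [], e, f => e = f
  | i :: l, e, f => (support i f).any fun g => path l e g

theorem transition_of_path {l : List (Fin 4)} {e f : Fin 10} (h : path l e f) :
    Transition (word l) e f := by
  induction l generalizing f with
  | nil =>
    rw [path, decide_eq_true_eq] at h
    exact h ▸ .one e
  | cons i l ih =>
    rw [path, List.any_eq_true] at h
    obtain ⟨g, h1, h2⟩ := h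
    exact (transition_of h1).mul (ih h2)

/-! ### Bounds for the canonical length -/

theorem nonpos_of_pre {x z : B5} (hxz : IsConj x z) {p : ℤ} (hp : Pre (Δ ^ p) z)
    {w : FreeMonoid (Fin 4)} (hw : braid w = x) {e : Fin 10} (he : Transition w e e) :
    p ≤ 0 := by
  by_contra! h
  obtain ⟨c, rfl⟩ := isConj_iff.1 hxz
  obtain ⟨a, ha⟩ := exists_isPos_mul c⁻¹
  obtain ⟨b, hb⟩ := exists_isPos_mul c
  set m : ℕ := 2 * (a + b) + 1 with hm
  have hz := hp.Δ_zpow_pow m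
  set N : ℤ := m * p with hN
  have hNm : (m : ℤ) ≤ N := by nlinarith
  obtain ⟨n, hn⟩ : ∃ n : ℕ, ((n + 1 : ℕ) : ℤ) = N - 2 * (a + b) := by
    refine ⟨(N - 2 * (a + b) - 1).toNat, ?_⟩
    push_cast
    rw [Int.toNat_of_nonneg] <;> omega
  have hpow : (Δ ^ 2) ^ (a + b) = Δ ^ (2 * (a + b) : ℤ) := by
    rw [← pow_mul, ← zpow_natCast]
    push_cast
    rfl
  have key : braid (w ^ m) = (c⁻¹ * (Δ ^ 2) ^ a) * ((Δ ^ (-N))⁻¹ *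
      ((Δ ^ N)⁻¹ * (c * x * c⁻¹) ^ m * (c * (Δ ^ 2) ^ b)) * Δ ^ (-N)) * Δ ^ (n + 1) := by
    have e1 : Δ ^ (n + 1) = Δ ^ N * ((Δ ^ 2) ^ (a + b))⁻¹ := by
      rw [← zpow_natCast, hn, hpow, zpow_sub]
    have e2 := ((commute_Δ_sq (x ^ m)).pow_right a).eq
    rw [map_pow, hw, e1, conj_pow, pow_add (Δ ^ 2), zpow_neg, mul_inv_rev]
    calc x ^ m = x ^ m * (Δ ^ 2) ^ a * ((Δ ^ 2) ^ a)⁻¹ := by group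
      _ = c⁻¹ * (c * (Δ ^ 2) ^ a) * x ^ m * ((Δ ^ 2) ^ a)⁻¹ := by rw [e2]; group
      _ = c⁻¹ * ((Δ ^ 2) ^ a * c) * x ^ m * ((Δ ^ 2) ^ a)⁻¹ := by
        rw [((commute_Δ_sq c).pow_right a).eq]
      _ = _ := by
        generalize (Δ ^ 2) ^ a = A, (Δ ^ 2) ^ b = B, Δ ^ N = D, x ^ m = X
        group
  obtain ⟨v, hv⟩ := (he.pow m).ne_zero
  exact hv (lkAct_zero_eq_zero (ha.mul (IsPos.conj_Δ_zpow (IsPos.mul hz hb) _)) key v)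

theorem le_of_pre {x z : B5} (hxz : IsConj x z) {q : ℤ} (hq : Pre z (Δ ^ q))
    {u : FreeMonoid (Fin 4)} {m : ℕ} (hu : x * braid u = Δ ^ (2 * m + 1)) {e : Fin 10}
    (he : Transition (u * flipWord u) e e) : ((2 * m + 1 : ℕ) : ℤ) ≤ q := by
  set n : ℕ := 2 * m + 1 with hn
  have hΔ : (Δ ^ 2) ^ n = Δ ^ (n + n : ℤ) := by
    rw [zpow_add, zpow_natCast, ← pow_mul, mul_comm, pow_mul, pow_two]
  have hw : braid (u * flipWord u) = x⁻¹ * x⁻¹ * (Δ ^ 2) ^ n := by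
    have h1 : braid u * Δ ^ n = Δ ^ n * braid (flipWord u) := by
      rw [hn, pow_succ, pow_mul, ← mul_assoc, ((commute_Δ_sq (braid u)).pow_right m).eq, mul_assoc,
        braid_mul_Δ, mul_assoc]
    have h2 : x = Δ ^ n * (braid u)⁻¹ := eq_mul_inv_of_mul_eq hu
    rw [map_mul, h2, hΔ, zpow_add, zpow_natCast]
    calc _ = braid u * ((Δ ^ n)⁻¹ * (Δ ^ n * braid (flipWord u))) := by group
      _ = _ := by rw [← h1]; group
  have hconj : IsConj (x⁻¹ * x⁻¹ * (Δ ^ 2) ^ n) (z⁻¹ * z⁻¹ * (Δ ^ 2) ^ n) := by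
    obtain ⟨c, rfl⟩ := isConj_iff.1 hxz
    refine isConj_iff.2 ⟨c, ?_⟩
    have := ((commute_Δ_sq c⁻¹).pow_right n).eq
    calc _ = c * (x⁻¹ * x⁻¹) * ((Δ ^ 2) ^ n * c⁻¹) := by simp only [mul_assoc]
      _ = _ := by rw [← this]; group
  have hz : Pre (Δ ^ (-q)) z⁻¹ := by
    have := IsPos.conj_Δ_zpow hq (-q)
    rwa [mul_assoc, mul_assoc, ← zpow_add, add_neg_cancel, zpow_zero, mul_one] at this
  have hc : Pre (Δ ^ (n + n : ℤ)) ((Δ ^ 2) ^ n) := by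
    rw [Pre, hΔ, inv_mul_cancel]
    exact isPos_braid 1
  have := nonpos_of_pre hconj ((hz.Δ_zpow_mul hz).Δ_zpow_mul hc) hw he
  omega

theorem exists_pre_pre (z : B5) : ∃ p q : ℤ, p ≤ q ∧ Pre (Δ ^ p) z ∧ Pre z (Δ ^ q) := by
  obtain ⟨a, ha⟩ := exists_isPos_mul z
  obtain ⟨b, hb⟩ := exists_isPos_mul z⁻¹
  refine ⟨-(2 * a : ℕ), (2 * b : ℕ), by omega, ?_, ?_⟩
  · rwa [Pre, zpow_neg, inv_inv, zpow_natCast, pow_mul,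
      ← ((commute_Δ_sq z).pow_right a).eq]
  · rwa [Pre, zpow_natCast, pow_mul]

theorem le_canLen {z : B5} {n : ℕ}
    (h : ∀ p q : ℤ, Pre (Δ ^ p) z → Pre z (Δ ^ q) → (n : ℤ) ≤ q - p) : n ≤ canLen z := by
  refine le_csInf ?_ ?_
  · obtain ⟨p, q, hpq, hp, hq⟩ := exists_pre_pre z
    exact ⟨(q - p).toNat, p, q, hpq, (Int.toNat_of_nonneg (sub_nonneg.2 hpq)).symm, hp, hq⟩
  · rintro m ⟨p, q, -, hm, hp, hq⟩
    have := h p q hp hq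
    omega

theorem canLen_le {z : B5} {n : ℕ} (h : IsPos z) (hn : Pre z (Δ ^ (n : ℤ))) : canLen z ≤ n :=
  Nat.sInf_le ⟨0, n, by positivity, by simp, by simpa [Pre] using h, hn⟩

/-! ### The two conjugates -/

/-- `PosPre n y` means `1 ≼ y ≼ Δ ^ n`. -/
def PosPre (n : ℤ) (y : B5) : Prop := IsPos y ∧ Pre y (Δ ^ n)

theorem PosPre.mul {a b : ℤ} {x y : B5} (hx : PosPre a x) (hy : PosPre b y) :
    PosPre (a + b) (x * y) := ⟨hx.1.mul hy.1, hx.2.mul_Δ_zpow hy.2⟩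

theorem PosPre.pow {a : ℤ} {x : B5} (hx : PosPre a x) (n : ℕ) : PosPre (n * a) (x ^ n) :=
  ⟨hx.1.pow n, hx.2.pow_Δ_zpow n⟩

theorem posPre_of_divWord {y : B5} (l : List (Fin 4)) (hy : braid (word l) = y)
    (h : (divWord l halfTwist).isSome) : PosPre 1 y :=
  hy ▸ ⟨isPos_braid _, pre_Δ_of_divWord h⟩

theorem mul_pow_of_eq_Δ_sq {x y : B5} (h : x * y = Δ ^ 2) (n : ℕ) :
    x ^ n * y ^ n = (Δ ^ 2) ^ n := by
  have : Commute x y := by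
    rw [eq_inv_mul_of_mul_eq h]
    exact (Commute.refl x).inv_right.mul_right (commute_Δ_sq x)
  rw [← h, this.mul_pow]

theorem braid_mul_eq_Δ_sq {l r : List (Fin 4)}
    (h : divWord l (halfTwist ++ halfTwist) = some r) :
    braid (word l) * braid (word r) = Δ ^ 2 := by
  rw [braid_of_divWord h, word, FreeMonoid.ofList_append, map_mul, braid_halfTwist, pow_two]

/-- A cyclic conjugate of the word defining `T' (j + 1)`. -/
def cycWord (j : ℕ) : FreeMonoid (Fin 4) :=
  word [1, 0, 3, 2, 3] * (word [0, 2, 0, 2] ^ j * word [2, 3, 1, 0, 1, 1, 0, 1, 3] *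
    word [1, 0, 3, 0, 1, 3] ^ j)

/-- The complement of `cycWord j` in `Δ ^ (4 * j + 3)`. -/
def cycCompl (j : ℕ) : FreeMonoid (Fin 4) :=
  word [0, 2, 3, 1, 2, 0, 1, 1, 2, 3, 0, 1, 2, 0] ^ j *
    word [2, 3, 1, 2, 0, 1, 1, 2, 3, 0, 1] *
    word [1, 2, 0, 1, 3, 2, 1, 0, 0, 1, 2, 3, 1, 2, 0, 1] ^ j * word [1, 2, 3, 0, 1]

theorem braid_cycWord_mul_cycCompl (j : ℕ) :
    braid (cycWord j) * braid (cycCompl j) = Δ ^ (2 * (2 * j + 1) + 1) := by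
  have hA : braid (word [0, 2, 0, 2]) *
      braid (word [1, 2, 0, 1, 3, 2, 1, 0, 0, 1, 2, 3, 1, 2, 0, 1]) = Δ ^ 2 :=
    braid_mul_eq_Δ_sq (by decide +kernel)
  have hB : braid (word [1, 0, 3, 0, 1, 3]) *
      braid (word [0, 2, 3, 1, 2, 0, 1, 1, 2, 3, 0, 1, 2, 0]) = Δ ^ 2 :=
    braid_mul_eq_Δ_sq (by decide +kernel)
  have hC : braid (word [2, 3, 1, 0, 1, 1, 0, 1, 3]) *
      braid (word [2, 3, 1, 2, 0, 1, 1, 2, 3, 0, 1]) = Δ ^ 2 :=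
    braid_mul_eq_Δ_sq (by decide +kernel)
  have hE : braid (word [1, 0, 3, 2, 3]) * braid (word [1, 2, 3, 0, 1]) = Δ := by
    rw [← braid_halfTwist]
    exact braid_of_divWord (by decide +kernel)
  have hA' := mul_pow_of_eq_Δ_sq hA j
  have hB' := mul_pow_of_eq_Δ_sq hB j
  simp only [cycWord, cycCompl, map_mul, map_pow]
  generalize braid (word [0, 2, 0, 2]) ^ j = A at *
  generalize braid (word [1, 2, 0, 1, 3, 2, 1, 0, 0, 1, 2, 3, 1, 2, 0, 1]) ^ j = A' at *
  generalize braid (word [1, 0, 3, 0, 1, 3]) ^ j = B at *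
  generalize braid (word [0, 2, 3, 1, 2, 0, 1, 1, 2, 3, 0, 1, 2, 0]) ^ j = B' at *
  generalize braid (word [2, 3, 1, 0, 1, 1, 0, 1, 3]) = C at *
  generalize braid (word [2, 3, 1, 2, 0, 1, 1, 2, 3, 0, 1]) = C' at *
  generalize braid (word [1, 0, 3, 2, 3]) = E at *
  generalize braid (word [1, 2, 3, 0, 1]) = E' at *
  have hZ (x : B5) : x * (Δ ^ 2) ^ j = (Δ ^ 2) ^ j * x := ((commute_Δ_sq x).pow_right j).eq
  calc E * (A * C * B) * (B' * C' * A' * E') = E * A * C * (B * B') * C' * A' * E' := by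
        simp only [mul_assoc]
    _ = (Δ ^ 2) ^ j * (E * A * (C * C') * A' * E') := by rw [hB', hZ]; simp only [mul_assoc]
    _ = (Δ ^ 2) ^ j * (Δ ^ 2 * (E * (A * A') * E')) := by
        rw [hC, (commute_Δ_sq (E * A)).eq]; simp only [mul_assoc]
    _ = (Δ ^ 2) ^ j * (Δ ^ 2 * ((Δ ^ 2) ^ j * (E * E'))) := by
        rw [hA', hZ]; simp only [mul_assoc]
    _ = Δ ^ (2 * (2 * j + 1) + 1) := by
        rw [hE, ← pow_mul, ← pow_succ, ← pow_add, ← pow_add]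
        congr 1
        ring

theorem transition_cycWord (j : ℕ) : Transition (cycWord j) 7 7 :=
  (transition_of_path (e := 1) (by decide)).mul
    ((((transition_of_path (e := 1) (by decide)).pow j).mul
      (transition_of_path (e := 7) (by decide))).mul
        ((transition_of_path (e := 7) (by decide)).pow j))

theorem transition_cycCompl (j : ℕ) : Transition (cycCompl j * flipWord (cycCompl j)) 9 9 := by
  have h : Transition (cycCompl j) 0 9 :=
    ((((transition_of_path (e := 9) (by decide)).pow j).mul
      (transition_of_path (e := 7) (by decide))).mul
        ((transition_of_path (e := 7) (by decide)).pow j)).mul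
          (transition_of_path (e := 0) (by decide))
  have h' : Transition (flipWord (cycCompl j)) 9 0 := by
    simp only [cycCompl, map_mul, map_pow]
    exact ((((transition_of_path (e := 0) (by decide)).pow j).mul
      (transition_of_path (e := 4) (by decide))).mul
        ((transition_of_path (e := 4) (by decide)).pow j)).mul
          (transition_of_path (e := 9) (by decide))
  exact h.mul h'

theorem T'_eq_braid (j : ℕ) : T' (j + 1) =
    braid (word [0, 2, 0, 2] ^ j * word [2, 3, 1, 0, 1, 1, 0, 1, 3] *
      word [1, 0, 3, 0, 1, 3] ^ j) * braid (word [1, 0, 3, 2, 3]) := by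
  have h : 2 * (j + 1) - 2 = 2 * j := by omega
  simp only [T', h, Nat.add_sub_cancel, map_mul, map_pow, pow_mul, pow_two, braid_word_cons,
    braid_word_nil, mul_one, mul_assoc, s1, s2, s3, s4, δ3, Δ3, δt3]

theorem isConj_T' (j : ℕ) : IsConj (T' (j + 1)) (braid (cycWord j)) := by
  rw [T'_eq_braid, cycWord, map_mul braid (word [1, 0, 3, 2, 3])]
  exact isConj_iff.2 ⟨braid (word [1, 0, 3, 2, 3]), by rw [← mul_assoc, mul_inv_cancel_right]⟩

theorem le_canLen_of_isConj_T' {k : ℕ} (hk : 2 ≤ k) {z : B5} (hz : IsConj (T' k) z) :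
    4 * k - 1 ≤ canLen z := by
  obtain ⟨j, rfl⟩ : ∃ j, k = j + 1 := ⟨k - 1, by omega⟩
  have hz' : IsConj (braid (cycWord j)) z := (isConj_T' j).symm.trans hz
  refine le_canLen fun p q hp hq => ?_
  have h1 := nonpos_of_pre hz' hp rfl (transition_cycWord j)
  have h2 := le_of_pre hz' hq (braid_cycWord_mul_cycCompl j) (transition_cycCompl j)
  omega

theorem conj_spec {k : ℕ} (hk : 2 ≤ k) {c y : B5} (h : c⁻¹ * T' k * c = y)
    (hy : PosPre ((4 * k - 1 : ℕ) : ℤ) y) :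
    IsPos (c⁻¹ * T' k * c) ∧ Pre (c⁻¹ * T' k * c) (Δ ^ (4 * k - 1)) ∧
      canLen (c⁻¹ * T' k * c) = 4 * k - 1 ∧ InSSS (T' k) (c⁻¹ * T' k * c) := by
  have hc : IsConj (T' k) (c⁻¹ * T' k * c) := isConj_iff.2 ⟨c⁻¹, by rw [inv_inv]⟩
  rw [h] at hc ⊢
  have hle := canLen_le hy.1 hy.2
  refine ⟨hy.1, ?_, hle.antisymm (le_canLen_of_isConj_T' hk hc), hc,
    fun z hz => hle.trans (le_canLen_of_isConj_T' hk hz)⟩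
  rw [← zpow_natCast]
  exact hy.2

theorem conj_s3_eq {k : ℕ} (hk : 2 ≤ k) : s3⁻¹ * T' k * s3 =
    (s1*s3)^(2*k-3) * (s3*s4*Δ3) * (Δ3*s4)^2 * (δt3*s4) *
      ((δ3*s4)*(δt3*s4))^(k-2) * (δ3*s4*s3*s4) * s3 := by
  obtain ⟨i, rfl⟩ : ∃ i, k = i + 2 := ⟨k - 2, by omega⟩
  have e1 : 2 * (i + 2) - 2 = 2 * i + 1 + 1 := by omega
  have e2 : 2 * (i + 2) - 3 = 2 * i + 1 := by omega
  have e3 : i + 2 - 1 = i + 1 := by omega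
  have h1 : Commute s3 (s1 * s3) := by
    have : s3 * s1 = s1 * s3 := gen_comm (by decide)
    rw [commute_iff_eq, ← mul_assoc, this]
  have h2 : s1 * s3 * (s3 * s4 * Δ3) * (Δ3 * s4) * ((δ3 * s4) * (δt3 * s4)) =
      s3 * (s3 * s4 * Δ3) * (Δ3 * s4) ^ 2 * (δt3 * s4) := by
    have : braid (word [0, 2, 2, 3, 1, 0, 1, 1, 0, 1, 3, 1, 0, 3, 0, 1, 3]) =
        braid (word [2, 2, 3, 1, 0, 1, 1, 0, 1, 3, 1, 0, 1, 3, 0, 1, 3]) :=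
      braid_eq_of_divWord (by decide +kernel)
    simpa only [braid_word_cons, braid_word_nil, mul_one, mul_assoc, pow_two, s1, s2, s3, s4, δ3,
      Δ3, δt3] using this
  rw [T', e1, e2, e3, Nat.add_sub_cancel, pow_succ (s1 * s3), pow_succ' (_ * _) i]
  generalize hP : (s1 * s3) ^ (2 * i + 1) = P
  have h3 : s3 * P = P * s3 := hP ▸ (h1.pow_right _).eq
  congr 1
  rw [inv_mul_eq_iff_eq_mul]
  calc _ = P * (s1 * s3 * (s3 * s4 * Δ3) * (Δ3 * s4) * ((δ3 * s4) * (δt3 * s4))) *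
        ((δ3 * s4) * (δt3 * s4)) ^ i * (δ3 * s4 * s3 * s4) := by simp only [mul_assoc]
    _ = P * s3 * ((s3 * s4 * Δ3) * (Δ3 * s4) ^ 2 * (δt3 * s4)) *
        ((δ3 * s4) * (δt3 * s4)) ^ i * (δ3 * s4 * s3 * s4) := by
      rw [h2]; simp only [mul_assoc]
    _ = _ := by rw [← h3]; simp only [mul_assoc]

theorem conj_s2s1s3s2_eq (k : ℕ) :
    (s2*s1*s3*s2)⁻¹ * T' k * (s2*s1*s3*s2) =
      (s3*s4*s3*Δ3) * (s2*s4)^(2*k-2) * (δ3*s3*s4*s3) * (s1*s4*s3) *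
        ((s1*s3*s4)*(s1*s4*s3))^(k-1) := by
  have h1 : SemiconjBy ((s2 * s1 * s3 * s2) * (s3 * s4 * s3 * Δ3)) (s2 * s4) (s1 * s3) := by
    have : braid (word [1, 0, 2, 1, 2, 3, 2, 1, 0, 1, 1, 3]) =
        braid (word [0, 2, 1, 0, 2, 1, 2, 3, 2, 1, 0, 1]) :=
      braid_eq_of_divWord (by decide +kernel)
    simpa only [SemiconjBy, braid_word_cons, braid_word_nil, mul_one, mul_assoc, s1, s2, s3, s4,
      Δ3] using this
  have h2 : SemiconjBy ((δ3 * s4 * s3 * s4) * (s2 * s1 * s3 * s2))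
      ((s1 * s3 * s4) * (s1 * s4 * s3)) ((δ3 * s4) * (δt3 * s4)) := by
    have : braid (word [1, 0, 3, 2, 3, 1, 0, 2, 1, 0, 2, 3, 0, 3, 2]) =
        braid (word [1, 0, 3, 0, 1, 3, 1, 0, 3, 2, 3, 1, 0, 2, 1]) :=
      braid_eq_of_divWord (by decide +kernel)
    simpa only [SemiconjBy, braid_word_cons, braid_word_nil, mul_one, mul_assoc, s1, s2, s3, s4,
      δ3, δt3] using this
  have h3 : (s3 * s4 * Δ3) * (Δ3 * s4) * ((δ3 * s4 * s3 * s4) * (s2 * s1 * s3 * s2)) =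
      (s2 * s1 * s3 * s2) * (s3 * s4 * s3 * Δ3) * ((δ3 * s3 * s4 * s3) * (s1 * s4 * s3)) := by
    have : braid (word [2, 3, 1, 0, 1, 1, 0, 1, 3, 1, 0, 3, 2, 3, 1, 0, 2, 1]) =
        braid (word [1, 0, 2, 1, 2, 3, 2, 1, 0, 1, 1, 0, 2, 3, 2, 0, 3, 2]) :=
      braid_eq_of_divWord (by decide +kernel)
    simpa only [braid_word_cons, braid_word_nil, mul_one, mul_assoc, s1, s2, s3, s4, δ3,
      Δ3] using this
  rw [mul_assoc, inv_mul_eq_iff_eq_mul, T']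
  have h4 := (h1.pow_right (2 * k - 2)).eq
  have h5 := (h2.pow_right (k - 1)).eq
  generalize (s1 * s3) ^ (2 * k - 2) = P at *
  generalize (s2 * s4) ^ (2 * k - 2) = P' at *
  generalize ((δ3 * s4) * (δt3 * s4)) ^ (k - 1) = Q at *
  generalize ((s1 * s3 * s4) * (s1 * s4 * s3)) ^ (k - 1) = Q' at *
  calc _ = P * (s3 * s4 * Δ3) * (Δ3 * s4) *
        (Q * ((δ3 * s4 * s3 * s4) * (s2 * s1 * s3 * s2))) := by simp only [mul_assoc]
    _ = P * ((s3 * s4 * Δ3) * (Δ3 * s4) * ((δ3 * s4 * s3 * s4) * (s2 * s1 * s3 * s2))) * Q' := by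
      rw [← h5]; simp only [mul_assoc]
    _ = P * ((s2 * s1 * s3 * s2) * (s3 * s4 * s3 * Δ3)) *
        ((δ3 * s3 * s4 * s3) * (s1 * s4 * s3)) * Q' := by rw [h3]; simp only [mul_assoc]
    _ = _ := by rw [← h4]; simp only [mul_assoc]

theorem posPre_conj_s3 {k : ℕ} (hk : 2 ≤ k) : PosPre ((4 * k - 1 : ℕ) : ℤ)
    ((s1*s3)^(2*k-3) * (s3*s4*Δ3) * (Δ3*s4)^2 * (δt3*s4) *
      ((δ3*s4)*(δt3*s4))^(k-2) * (δ3*s4*s3*s4) * s3) := by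
  have h1 : PosPre 1 (s1 * s3) := posPre_of_divWord [0, 2]
    (by simp only [braid_word_cons, braid_word_nil, mul_one, s1, s3]) (by decide +kernel)
  have h2 : PosPre 1 (s3 * s4 * Δ3) := posPre_of_divWord [2, 3, 1, 0, 1]
    (by simp only [braid_word_cons, braid_word_nil, mul_one, mul_assoc, s1, s2, s3, s4, Δ3])
    (by decide +kernel)
  have h3 : PosPre 1 (Δ3 * s4) := posPre_of_divWord [1, 0, 1, 3]
    (by simp only [braid_word_cons, braid_word_nil, mul_one, mul_assoc, s1, s2, s4, Δ3])
    (by decide +kernel)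
  have h4 : PosPre 1 (δt3 * s4) := posPre_of_divWord [0, 1, 3]
    (by simp only [braid_word_cons, braid_word_nil, mul_one, mul_assoc, s1, s2, s4, δt3])
    (by decide +kernel)
  have h5 : PosPre 1 (δ3 * s4) := posPre_of_divWord [1, 0, 3]
    (by simp only [braid_word_cons, braid_word_nil, mul_one, mul_assoc, s1, s2, s4, δ3])
    (by decide +kernel)
  have h6 : PosPre 1 (δ3 * s4 * s3 * s4) := posPre_of_divWord [1, 0, 3, 2, 3]
    (by simp only [braid_word_cons, braid_word_nil, mul_one, mul_assoc, s1, s2, s3, s4, δ3])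
    (by decide +kernel)
  have h7 : PosPre 1 s3 := posPre_of_divWord [2]
    (by simp only [braid_word_cons, braid_word_nil, mul_one, s3]) (by decide +kernel)
  convert ((((((h1.pow (2 * k - 3)).mul h2).mul (h3.pow 2)).mul h4).mul
    ((h5.mul h4).pow (k - 2))).mul h6).mul h7 using 1
  omega

theorem posPre_conj_s2s1s3s2 {k : ℕ} (hk : 2 ≤ k) : PosPre ((4 * k - 1 : ℕ) : ℤ)
    ((s3*s4*s3*Δ3) * (s2*s4)^(2*k-2) * (δ3*s3*s4*s3) * (s1*s4*s3) *
      ((s1*s3*s4)*(s1*s4*s3))^(k-1)) := by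
  have h1 : PosPre 1 (s3 * s4 * s3 * Δ3) := posPre_of_divWord [2, 3, 2, 1, 0, 1]
    (by simp only [braid_word_cons, braid_word_nil, mul_one, mul_assoc, s1, s2, s3, s4, Δ3])
    (by decide +kernel)
  have h2 : PosPre 1 (s2 * s4) := posPre_of_divWord [1, 3]
    (by simp only [braid_word_cons, braid_word_nil, mul_one, s2, s4]) (by decide +kernel)
  have h3 : PosPre 1 (δ3 * s3 * s4 * s3) := posPre_of_divWord [1, 0, 2, 3, 2]
    (by simp only [braid_word_cons, braid_word_nil, mul_one, mul_assoc, s1, s2, s3, s4, δ3])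
    (by decide +kernel)
  have h4 : PosPre 1 (s1 * s4 * s3) := posPre_of_divWord [0, 3, 2]
    (by simp only [braid_word_cons, braid_word_nil, mul_one, mul_assoc, s1, s3, s4])
    (by decide +kernel)
  have h5 : PosPre 1 (s1 * s3 * s4) := posPre_of_divWord [0, 2, 3]
    (by simp only [braid_word_cons, braid_word_nil, mul_one, mul_assoc, s1, s3, s4])
    (by decide +kernel)
  convert (((h1.mul (h2.pow (2 * k - 2))).mul h3).mul h4).mul ((h5.mul h4).pow (k - 1)) using 1
  omega

/-- the conjugates `σ₃⁻¹ T'_k σ₃` and `(σ₂σ₁σ₃σ₂)⁻¹ T'_k (σ₂σ₁σ₃σ₂)`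
are positive prefixes of `Δ^{4k-1}`, have canonical length `4k-1`, belong to the
super summit set of `T'_k`, and have the displayed explicit forms. -/
theorem conj_s3_in_SSS (k : ℕ) (hk : 2 ≤ k) :
    (IsPos (s3⁻¹ * T' k * s3) ∧ Pre (s3⁻¹ * T' k * s3) (Δ ^ (4*k-1)) ∧
      canLen (s3⁻¹ * T' k * s3) = 4*k - 1 ∧ InSSS (T' k) (s3⁻¹ * T' k * s3)) ∧
    (IsPos ((s2*s1*s3*s2)⁻¹ * T' k * (s2*s1*s3*s2)) ∧
      Pre ((s2*s1*s3*s2)⁻¹ * T' k * (s2*s1*s3*s2)) (Δ ^ (4*k-1)) ∧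
      canLen ((s2*s1*s3*s2)⁻¹ * T' k * (s2*s1*s3*s2)) = 4*k - 1 ∧
      InSSS (T' k) ((s2*s1*s3*s2)⁻¹ * T' k * (s2*s1*s3*s2))) ∧
    s3⁻¹ * T' k * s3 =
      (s1*s3)^(2*k-3) * (s3*s4*Δ3) * (Δ3*s4)^2 * (δt3*s4) *
        ((δ3*s4)*(δt3*s4))^(k-2) * (δ3*s4*s3*s4) * s3 ∧
    (s2*s1*s3*s2)⁻¹ * T' k * (s2*s1*s3*s2) =
      (s3*s4*s3*Δ3) * (s2*s4)^(2*k-2) * (δ3*s3*s4*s3) * (s1*s4*s3) *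
        ((s1*s3*s4)*(s1*s4*s3))^(k-1) := by
  exact ⟨conj_spec hk (conj_s3_eq hk) (posPre_conj_s3 hk),
    conj_spec hk (conj_s2s1s3s2_eq k) (posPre_conj_s2s1s3s2 hk), conj_s3_eq hk,
    conj_s2s1s3s2_eq k⟩
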